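/- Let A be a finite-dimensional solvable Leibniz algebra over a perfect field. Then the following are equivalent: (1) A is elementary; (2) Φ(A) = 0 and A² is nilpotent; (3) Φ(A) = 0 and A is metabelian; (4) Asoc(A) is complemented by an abelian subalgebra of A. -/

import Mathlib

namespace Leib

variable {K : Type*} [Field K] {A : Type*} [AddCommGroup A] [Module K A]

variable (mul : A →ₗ[K] A →ₗ[K] A)

/-- The (left) Leibniz identity: left multiplication is a derivation. -/
def IsLeibniz : Prop :=
  ∀ x y z : A, mul x (mul y z) = mul (mul x y) z + mul y (mul x z)

/-- The product of two submodules: the span of all products. -/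
def prodSM (B C : Submodule K A) : Submodule K A :=
  Submodule.span K {z | ∃ b ∈ B, ∃ c ∈ C, z = mul b c}

/-- A subalgebra: a submodule closed under multiplication. -/
def IsSubalg (S : Submodule K A) : Prop :=
  ∀ x ∈ S, ∀ y ∈ S, mul x y ∈ S

/-- A (two-sided) ideal. -/
def IsIdeal (B : Submodule K A) : Prop :=
  ∀ a : A, ∀ b ∈ B, mul a b ∈ B ∧ mul b a ∈ B

/-- An abelian subspace: all products vanish. -/
def IsAbelian (B : Submodule K A) : Prop :=
  ∀ x ∈ B, ∀ y ∈ B, mul x y = 0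

/-- A minimal ideal. -/
def IsMinIdeal (B : Submodule K A) : Prop :=
  IsIdeal mul B ∧ B ≠ ⊥ ∧ ∀ C : Submodule K A, IsIdeal mul C → C ≤ B → C = ⊥ ∨ C = B

/-- Lower central series of a subalgebra `B`: `B, B·B, B·(B·B), ...`. -/
def lcsOf (B : Submodule K A) : ℕ → Submodule K A
  | 0 => B
  | n + 1 => prodSM mul B (lcsOf B n)

/-- A nilpotent subalgebra. -/
def IsNilpotentSubalg (B : Submodule K A) : Prop := ∃ n, lcsOf mul B n = ⊥

/-- A nilpotent algebra. -/
def IsNilpotentAlg : Prop := ∃ n, lcsOf mul ⊤ n = ⊥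

/-- Derived series of a subalgebra. -/
def derOf (B : Submodule K A) : ℕ → Submodule K A
  | 0 => B
  | n + 1 => prodSM mul (derOf B n) (derOf B n)

/-- A solvable subalgebra. -/
def IsSolvableSubalg (B : Submodule K A) : Prop := ∃ n, derOf mul B n = ⊥

/-- A solvable algebra. -/
def IsSolvableAlg : Prop := ∃ n, derOf mul ⊤ n = ⊥

/-- A semisimple algebra: no nonzero solvable ideal. -/
def IsSemisimpleAlg : Prop :=
  ∀ B : Submodule K A, IsIdeal mul B → IsSolvableSubalg mul B → B = ⊥

/-- The nilradical: the largest nilpotent ideal (here: the sup of all nilpotent ideals). -/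
def nilrad : Submodule K A :=
  sSup {B : Submodule K A | IsIdeal mul B ∧ IsNilpotentSubalg mul B}

/-- The socle: the sum of all minimal ideals. -/
def socle : Submodule K A := sSup {B : Submodule K A | IsMinIdeal mul B}

/-- The abelian socle: the sum of all abelian minimal ideals. -/
def asocle : Submodule K A :=
  sSup {B : Submodule K A | IsMinIdeal mul B ∧ IsAbelian mul B}

/-- The centralizer of a subspace `W`: elements annihilating `W` on both sides. -/
def centralizer (W : Submodule K A) : Submodule K A where
  carrier := {x | ∀ w ∈ W, mul x w = 0 ∧ mul w x = 0}
  add_mem' := by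
    intro a b ha hb w hw
    constructor
    · simp [map_add, (ha w hw).1, (hb w hw).1]
    · simp [map_add, (ha w hw).2, (hb w hw).2]
  zero_mem' := by intro w hw; simp
  smul_mem' := by
    intro c a ha w hw
    constructor
    · simp [map_smul, (ha w hw).1]
    · simp [map_smul, (ha w hw).2]

/-- The center of the algebra. -/
def center : Submodule K A := centralizer mul ⊤

/-- A maximal (proper) subalgebra of a subalgebra `M`. -/
def IsMaxSubalgIn (M S : Submodule K A) : Prop :=
  S ≤ M ∧ IsSubalg mul S ∧ S ≠ M ∧
    ∀ T : Submodule K A, T ≤ M → IsSubalg mul T → S ≤ T → T = S ∨ T = M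

/-- The Frattini subalgebra of `M`: the intersection of its maximal subalgebras
(equal to `M` if there are none). -/
def frattiniSubalgIn (M : Submodule K A) : Submodule K A :=
  M ⊓ sInf {S : Submodule K A | IsMaxSubalgIn mul M S}

/-- An ideal of the subalgebra `M`. -/
def IsIdealIn (M C : Submodule K A) : Prop :=
  C ≤ M ∧ ∀ x ∈ M, ∀ c ∈ C, mul x c ∈ C ∧ mul c x ∈ C

/-- The Frattini ideal of `M`: the largest ideal of `M` contained in its
Frattini subalgebra. -/
def frattiniIdealIn (M : Submodule K A) : Submodule K A :=
  sSup {C : Submodule K A | IsIdealIn mul M C ∧ C ≤ frattiniSubalgIn mul M}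

/-- The Frattini subalgebra of the algebra. -/
def frattiniSubalg : Submodule K A := frattiniSubalgIn mul ⊤

/-- The Frattini ideal of the algebra. -/
def frattiniIdeal : Submodule K A := frattiniIdealIn mul ⊤

/-- An elementary algebra: every subalgebra has zero Frattini ideal. -/
def IsElementary : Prop :=
  ∀ M : Submodule K A, IsSubalg mul M → frattiniIdealIn mul M = ⊥

/-- The derived subalgebra `A² = A·A`. -/
def derivedSubalg : Submodule K A := prodSM mul ⊤ ⊤

/-- A Cartan subalgebra: a nilpotent, self-normalizing subalgebra. -/
def IsCartan (H : Submodule K A) : Prop :=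
  IsSubalg mul H ∧ IsNilpotentSubalg mul H ∧
    ∀ x : A, (∀ h ∈ H, mul x h ∈ H ∧ mul h x ∈ H) → x ∈ H

end Leib

namespace Leib

section Elementary

variable {K : Type*} [Field K] {A : Type*} [AddCommGroup A] [Module K A]
variable {mul : A →ₗ[K] A →ₗ[K] A}

theorem mul_mem_prodSM {B C : Submodule K A} {b c : A} (hb : b ∈ B) (hc : c ∈ C) :
    mul b c ∈ prodSM mul B C :=
  Submodule.subset_span ⟨b, hb, c, hc, rfl⟩

theorem prodSM_le {B C D : Submodule K A} :
    prodSM mul B C ≤ D ↔ ∀ b ∈ B, ∀ c ∈ C, mul b c ∈ D := by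
  refine ⟨fun h b hb c hc => h (mul_mem_prodSM hb hc), fun h => Submodule.span_le.2 ?_⟩
  rintro _ ⟨b, hb, c, hc, rfl⟩
  exact h b hb c hc

theorem prodSM_mono {B B' C C' : Submodule K A} (hB : B ≤ B') (hC : C ≤ C') :
    prodSM mul B C ≤ prodSM mul B' C' :=
  prodSM_le.2 fun _ hb _ hc => mul_mem_prodSM (hB hb) (hC hc)

theorem isAbelian_iff_prodSM_eq_bot {B : Submodule K A} :
    IsAbelian mul B ↔ prodSM mul B B = ⊥ := by
  rw [eq_bot_iff, prodSM_le]
  rfl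

theorem IsAbelian.mono {B C : Submodule K A} (hC : IsAbelian mul C) (h : B ≤ C) :
    IsAbelian mul B :=
  fun x hx y hy => hC x (h hx) y (h hy)

theorem isIdealIn_top {B : Submodule K A} : IsIdealIn mul ⊤ B ↔ IsIdeal mul B :=
  ⟨fun h a b hb => h.2 a trivial b hb, fun h => ⟨le_top, fun a _ b hb => h a b hb⟩⟩

theorem IsIdealIn.isSubalg {M B : Submodule K A} (h : IsIdealIn mul M B) : IsSubalg mul B :=
  fun x hx y hy => (h.2 x (h.1 hx) y hy).1

theorem IsIdealIn.sup_isSubalg {M I T : Submodule K A} (hI : IsIdealIn mul M I) (hTM : T ≤ M)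
    (hT : IsSubalg mul T) : IsSubalg mul (I ⊔ T) := by
  intro x hx y hy
  obtain ⟨i, hi, t, ht, rfl⟩ := Submodule.mem_sup.1 hx
  obtain ⟨j, hj, u, hu, rfl⟩ := Submodule.mem_sup.1 hy
  have hx' : i + t ∈ M := M.add_mem (hI.1 hi) (hTM ht)
  have h : mul (i + t) (j + u) = (mul (i + t) j + mul i u) + mul t u := by
    simp only [map_add, LinearMap.add_apply]
    abel
  rw [h]
  exact Submodule.add_mem_sup (I.add_mem (hI.2 _ hx' _ hj).1 (hI.2 _ (hTM hu) _ hi).2)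
    (hT t ht u hu)

theorem frattiniIdealIn_eq_bot_iff [FiniteDimensional K A] {M : Submodule K A} :
    frattiniIdealIn mul M = ⊥ ↔ ∀ I, IsIdealIn mul M I → I ≠ ⊥ →
      ∃ T ≤ M, IsSubalg mul T ∧ T ≠ M ∧ I ⊔ T = M := by
  constructor
  · intro h I hI hI0
    have hnot : ¬ I ≤ frattiniSubalgIn mul M := fun hle =>
      hI0 (eq_bot_iff.2 (h ▸ le_sSup (a := I) ⟨hI, hle⟩))
    have : ∃ S, IsMaxSubalgIn mul M S ∧ ¬ I ≤ S := by
      by_contra! hcon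
      exact hnot (le_inf hI.1 (le_sInf fun S hS => hcon S hS))
    obtain ⟨S, hS, hIS⟩ := this
    refine ⟨S, hS.1, hS.2.1, hS.2.2.1, ?_⟩
    refine (hS.2.2.2 (I ⊔ S) (sup_le hI.1 hS.1) (hI.sup_isSubalg hS.1 hS.2.1)
      le_sup_right).resolve_left fun h' => hIS (h' ▸ le_sup_left)
  · intro h
    refine sSup_eq_bot.2 fun C hC => ?_
    by_contra hC0
    obtain ⟨T, hTM, hT, hne, hsup⟩ := h C hC.1 hC0
    obtain ⟨S, hTS, hS⟩ := exists_maximal_ge_of_wellFoundedGT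
      (fun S : Submodule K A => S ≤ M ∧ IsSubalg mul S ∧ S ≠ M) T ⟨hTM, hT, hne⟩
    have hmax : IsMaxSubalgIn mul M S := by
      refine ⟨hS.prop.1, hS.prop.2.1, hS.prop.2.2, fun T' hT'M hT' hST' => ?_⟩
      by_cases hT'e : T' = M
      · exact Or.inr hT'e
      · exact Or.inl (le_antisymm (hS.le_of_ge ⟨hT'M, hT', hT'e⟩ hST') hST')
    have hCS : C ≤ S := (hC.2.trans inf_le_right).trans (sInf_le hmax)
    exact hmax.2.2.1 (le_antisymm hmax.1 (hsup ▸ sup_le hCS hTS))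

/-- If the Frattini ideal of `M` vanishes, then abelian ideals of `M` split. -/
theorem exists_isSubalg_complement [FiniteDimensional K A] {M I : Submodule K A}
    (hM : IsSubalg mul M) (hΦ : frattiniIdealIn mul M = ⊥) (hI : IsIdealIn mul M I)
    (hab : IsAbelian mul I) : ∃ T ≤ M, IsSubalg mul T ∧ I ⊔ T = M ∧ I ⊓ T = ⊥ := by
  rw [frattiniIdealIn_eq_bot_iff] at hΦ
  obtain ⟨T, hT⟩ := exists_minimal_of_wellFoundedLT
    (fun T : Submodule K A => T ≤ M ∧ IsSubalg mul T ∧ I ⊔ T = M)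
    ⟨M, le_rfl, hM, sup_eq_right.2 hI.1⟩
  obtain ⟨hTM, hTs, hTsup⟩ := hT.prop
  refine ⟨T, hTM, hTs, hTsup, ?_⟩
  by_contra hne
  have hP : IsIdealIn mul M (I ⊓ T) := by
    refine ⟨inf_le_left.trans hI.1, fun x hx c hc => ?_⟩
    refine ⟨⟨(hI.2 x hx c hc.1).1, ?_⟩, ⟨(hI.2 x hx c hc.1).2, ?_⟩⟩ <;>
    · rw [← hTsup] at hx
      obtain ⟨i, hi, t, ht, rfl⟩ := Submodule.mem_sup.1 hx
      simp only [map_add, LinearMap.add_apply, hab i hi c hc.1, hab c hc.1 i hi, zero_add]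
      first
      | exact hTs t ht c hc.2
      | exact hTs c hc.2 t ht
  obtain ⟨T', hT'M, hT's, hT'ne, hT'sup⟩ := hΦ _ hP hne
  have hle : T ≤ T' := by
    have hsplit : (I ⊓ T) ⊔ (T' ⊓ T) = T := by
      rw [← sup_inf_assoc_of_le _ (inf_le_right : I ⊓ T ≤ T), hT'sup, inf_eq_right.2 hTM]
    have : T ≤ T' ⊓ T := by
      refine hT.le_of_le ⟨inf_le_right.trans hTM,
        fun x hx y hy => ⟨hT's x hx.1 y hy.1, hTs x hx.2 y hy.2⟩, ?_⟩ inf_le_right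
      refine le_antisymm (sup_le hI.1 (inf_le_right.trans hTM)) ?_
      rw [← hTsup]
      refine sup_le le_sup_left ?_
      exact hsplit.ge.trans (sup_le_sup_right inf_le_left _)
    exact this.trans inf_le_left
  exact hT'ne (le_antisymm hT'M (hT'sup ▸ sup_le (inf_le_right.trans hle) le_rfl))

/-- If the Frattini ideal of `M` vanishes, then abelian ideals of `M` are completely reducible. -/
theorem exists_isIdealIn_complement [FiniteDimensional K A] {M I J : Submodule K A}
    (hM : IsSubalg mul M) (hΦ : frattiniIdealIn mul M = ⊥) (hI : IsIdealIn mul M I)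
    (hab : IsAbelian mul I) (hJ : IsIdealIn mul M J) (hJI : J ≤ I) :
    ∃ J', IsIdealIn mul M J' ∧ J' ≤ I ∧ J ⊔ J' = I ∧ J ⊓ J' = ⊥ := by
  obtain ⟨T, hTM, hTs, hsup, hinf⟩ := exists_isSubalg_complement hM hΦ hJ (hab.mono hJI)
  refine ⟨T ⊓ I, ⟨inf_le_left.trans hTM, fun x hx c hc => ?_⟩, inf_le_right, ?_, ?_⟩
  · refine ⟨⟨?_, (hI.2 x hx c hc.2).1⟩, ⟨?_, (hI.2 x hx c hc.2).2⟩⟩ <;>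
    · rw [← hsup] at hx
      obtain ⟨i, hi, t, ht, rfl⟩ := Submodule.mem_sup.1 hx
      simp only [map_add, LinearMap.add_apply, hab i (hJI hi) c hc.2, hab c hc.2 i (hJI hi),
        zero_add]
      first
      | exact hTs t ht c hc.1
      | exact hTs c hc.1 t ht
  · rw [← sup_inf_assoc_of_le _ hJI, hsup, inf_eq_right.2 hI.1]
  · rw [← inf_assoc, hinf, bot_inf_eq]

theorem IsLeibniz.mul_mul_apply (hleib : IsLeibniz mul) (x y z : A) :
    mul (mul x y) z = mul x (mul y z) - mul y (mul x z) :=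
  eq_sub_of_add_eq (hleib x y z).symm

/-- The symmetrized product of two ideals is an ideal. -/
theorem IsIdealIn.prodSM_sup_prodSM (hleib : IsLeibniz mul) {M B C : Submodule K A}
    (hB : IsIdealIn mul M B) (hC : IsIdealIn mul M C) :
    IsIdealIn mul M (prodSM mul B C ⊔ prodSM mul C B) := by
  have key : ∀ B C : Submodule K A, IsIdealIn mul M B → IsIdealIn mul M C → ∀ a ∈ M,
      ∀ b ∈ B, ∀ c ∈ C, mul a (mul b c) ∈ prodSM mul B C ⊔ prodSM mul C B ∧
        mul (mul b c) a ∈ prodSM mul B C ⊔ prodSM mul C B := by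
    intro B C hB hC a ha b hb c hc
    constructor
    · rw [hleib a b c]
      exact Submodule.mem_sup_left (add_mem (mul_mem_prodSM (hB.2 a ha b hb).1 hc)
        (mul_mem_prodSM hb (hC.2 a ha c hc).1))
    · rw [hleib.mul_mul_apply]
      exact sub_mem (Submodule.mem_sup_left (mul_mem_prodSM hb (hC.2 a ha c hc).2))
        (Submodule.mem_sup_right (mul_mem_prodSM hc (hB.2 a ha b hb).2))
  have key' := key C B hC hB
  rw [sup_comm] at key'
  refine ⟨sup_le (prodSM_le.2 fun b hb c hc => hC.1 (hC.2 b (hB.1 hb) c hc).1)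
    (prodSM_le.2 fun c hc b hb => hB.1 (hB.2 c (hC.1 hc) b hb).1), fun a ha v hv => ⟨?_, ?_⟩⟩
  · have h : prodSM mul B C ⊔ prodSM mul C B ≤
        (prodSM mul B C ⊔ prodSM mul C B).comap (mul a) :=
      sup_le (prodSM_le.2 fun b hb c hc => (key B C hB hC a ha b hb c hc).1)
        (prodSM_le.2 fun c hc b hb => (key' a ha c hc b hb).1)
    exact h hv
  · have h : prodSM mul B C ⊔ prodSM mul C B ≤
        (prodSM mul B C ⊔ prodSM mul C B).comap (mul.flip a) :=
      sup_le (prodSM_le.2 fun b hb c hc => (key B C hB hC a ha b hb c hc).2)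
        (prodSM_le.2 fun c hc b hb => (key' a ha c hc b hb).2)
    exact h hv

theorem IsIdealIn.prodSM_self (hleib : IsLeibniz mul) {M D : Submodule K A}
    (hD : IsIdealIn mul M D) : IsIdealIn mul M (prodSM mul D D) := by
  simpa using hD.prodSM_sup_prodSM hleib hD

theorem IsSubalg.isIdealIn_self {M : Submodule K A} (hM : IsSubalg mul M) : IsIdealIn mul M M :=
  ⟨le_rfl, fun x hx c hc => ⟨hM x hx c hc, hM c hc x hx⟩⟩

theorem IsIdealIn.inf {M I J : Submodule K A} (hI : IsIdealIn mul M I) (hJ : IsIdealIn mul M J) :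
    IsIdealIn mul M (I ⊓ J) :=
  ⟨inf_le_left.trans hI.1, fun x hx c hc =>
    ⟨⟨(hI.2 x hx c hc.1).1, (hJ.2 x hx c hc.2).1⟩, ⟨(hI.2 x hx c hc.1).2, (hJ.2 x hx c hc.2).2⟩⟩⟩

theorem isIdealIn_derOf (hleib : IsLeibniz mul) {M : Submodule K A} (hM : IsSubalg mul M) (n : ℕ) :
    IsIdealIn mul M (derOf mul M n) := by
  induction n with
  | zero => exact hM.isIdealIn_self
  | succ n ih => exact ih.prodSM_self hleib

theorem derOf_mono {B C : Submodule K A} (h : B ≤ C) (n : ℕ) : derOf mul B n ≤ derOf mul C n := by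
  induction n with
  | zero => exact h
  | succ n ih => exact prodSM_mono ih ih

theorem IsSolvableAlg.isSolvableSubalg (h : IsSolvableAlg mul) (M : Submodule K A) :
    IsSolvableSubalg mul M := by
  obtain ⟨n, hn⟩ := h
  exact ⟨n, eq_bot_iff.2 (hn ▸ derOf_mono le_top n)⟩

theorem exists_isAbelian_isIdealIn (hleib : IsLeibniz mul) {M : Submodule K A}
    (hM : IsSubalg mul M) (hsolv : IsSolvableSubalg mul M) (hM0 : M ≠ ⊥) :
    ∃ D, IsIdealIn mul M D ∧ IsAbelian mul D ∧ D ≠ ⊥ := by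
  classical
  obtain ⟨k, hk⟩ : ∃ k, Nat.find hsolv = k + 1 :=
    Nat.exists_eq_succ_of_ne_zero fun h => hM0 <| by
      have := Nat.find_spec hsolv
      rwa [h] at this
  refine ⟨derOf mul M k, isIdealIn_derOf hleib hM k, ?_, Nat.find_min hsolv (by omega)⟩
  have := Nat.find_spec hsolv
  rw [hk] at this
  exact isAbelian_iff_prodSM_eq_bot.2 this

theorem exists_minimal_isIdealIn_le [FiniteDimensional K A] {M D : Submodule K A}
    (hD : IsIdealIn mul M D) (hD0 : D ≠ ⊥) :
    ∃ S ≤ D, IsIdealIn mul M S ∧ S ≠ ⊥ ∧ ∀ J, IsIdealIn mul M J → J ≤ S → J = ⊥ ∨ J = S := by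
  obtain ⟨S, hSD, hS⟩ := exists_minimal_le_of_wellFoundedLT
    (fun S : Submodule K A => IsIdealIn mul M S ∧ S ≠ ⊥) D ⟨hD, hD0⟩
  refine ⟨S, hSD, hS.prop.1, hS.prop.2, fun J hJ hJS => ?_⟩
  by_cases hJ0 : J = ⊥
  · exact Or.inl hJ0
  · exact Or.inr (le_antisymm hJS (hS.le_of_le ⟨hJ, hJ0⟩ hJS))

/-- On a minimal ideal, right multiplications either all vanish or are all the opposites of the
left multiplications. -/
theorem right_mul_eq_zero_or_neg (hleib : IsLeibniz mul) {M S : Submodule K A}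
    (hM : IsSubalg mul M) (hS : IsIdealIn mul M S)
    (hmin : ∀ J, IsIdealIn mul M J → J ≤ S → J = ⊥ ∨ J = S) :
    (∀ x ∈ M, ∀ s ∈ S, mul s x = 0) ∨ (∀ x ∈ M, ∀ s ∈ S, mul s x = -mul x s) := by
  let J : Submodule K A := Submodule.span K {z | ∃ x ∈ M, ∃ s ∈ S, z = mul x s + mul s x}
  have hgen : ∀ x ∈ M, ∀ s ∈ S, mul x s + mul s x ∈ J := fun x hx s hs =>
    Submodule.subset_span ⟨x, hx, s, hs, rfl⟩
  have hJS : J ≤ S := by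
    refine Submodule.span_le.2 ?_
    rintro _ ⟨x, hx, s, hs, rfl⟩
    exact S.add_mem (hS.2 x hx s hs).1 (hS.2 x hx s hs).2
  have hright : ∀ a ∈ M, J ≤ LinearMap.ker (mul.flip a) := by
    intro a ha
    refine Submodule.span_le.2 ?_
    rintro _ ⟨x, hx, s, hs, rfl⟩
    simp [hleib.mul_mul_apply]
  have hleft : ∀ a ∈ M, J ≤ J.comap (mul a) := by
    intro a ha
    refine Submodule.span_le.2 ?_
    rintro _ ⟨x, hx, s, hs, rfl⟩
    have h : mul a (mul x s + mul s x) =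
        (mul (mul a x) s + mul s (mul a x)) + (mul x (mul a s) + mul (mul a s) x) := by
      rw [map_add, hleib a x s, hleib a s x]
      abel
    change mul a (mul x s + mul s x) ∈ J
    rw [h]
    exact J.add_mem (hgen _ (hM a ha x hx) s hs) (hgen x hx _ (hS.2 a ha s hs).1)
  have hJ : IsIdealIn mul M J := ⟨hJS.trans hS.1, fun a ha c hc => ⟨hleft a ha hc, by
    rw [show mul c a = 0 from hright a ha hc]
    exact J.zero_mem⟩⟩
  rcases hmin J hJ hJS with h | h
  · right
    intro x hx s hs
    have := hgen x hx s hs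
    rw [h, Submodule.mem_bot] at this
    exact eq_neg_of_add_eq_zero_right this
  · left
    intro x hx s hs
    exact hright x hx (h ▸ hs)

/-- Over a perfect field, a semisimple endomorphism commuting with one of its commutators
`a * f - f * a` already commutes with `a`. -/
theorem commutator_eq_zero_of_isSemisimple [PerfectField K] {V : Type*} [AddCommGroup V]
    [Module K V] [FiniteDimensional K V] {a f : Module.End K V} (hf : f.IsSemisimple)
    (h : Commute f (a * f - f * a)) : a * f - f * a = 0 := by
  have hcomm : ∀ p : Polynomial K, Commute (Polynomial.aeval f p) (a * f - f * a) := by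
    intro p
    refine Algebra.commute_of_mem_adjoin_singleton_of_commute
      (Polynomial.aeval_mem_adjoin_singleton K f) h.symm |>.symm
  have key : ∀ p : Polynomial K, a * Polynomial.aeval f p - Polynomial.aeval f p * a =
      (a * f - f * a) * Polynomial.aeval f (Polynomial.derivative p) := by
    intro p
    induction p using Polynomial.induction_on with
    | C c => simp [Algebra.commutes c a]
    | add p q hp hq =>
      simp only [map_add, mul_add, add_mul, ← hp, ← hq]
      abel
    | monomial n c ih =>
      rw [pow_succ, ← mul_assoc]
      generalize Polynomial.C c * Polynomial.X ^ n = p at ih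
      have h1 : a * (Polynomial.aeval f p * f) - Polynomial.aeval f p * f * a =
          (a * Polynomial.aeval f p - Polynomial.aeval f p * a) * f +
            Polynomial.aeval f p * (a * f - f * a) := by
        noncomm_ring
      rw [map_mul, Polynomial.aeval_X, h1, ih, (hcomm p).eq]
      simp [mul_add, mul_assoc]
  have hsep : (minpoly K f).Separable :=
    PerfectField.separable_iff_squarefree.2 hf.minpoly_squarefree
  obtain ⟨u, v, huv⟩ := hsep
  have h0 := key (minpoly K f)
  simp only [minpoly.aeval, mul_zero, zero_mul, sub_zero] at h0
  have h1 := congrArg (Polynomial.aeval f) huv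
  simp only [map_add, map_mul, minpoly.aeval, mul_zero, zero_add, map_one] at h1
  have h2 : Commute (Polynomial.aeval f v) (Polynomial.aeval f
      (Polynomial.derivative (minpoly K f))) := by
    rw [commute_iff_eq, ← map_mul, ← map_mul, mul_comm]
  rw [← mul_one (a * f - f * a), ← h1, h2.eq, ← mul_assoc, ← h0, zero_mul]

theorem isCompl_comap_subtype {S W J : Submodule K A} (hW : W ≤ S) (hJ : J ≤ S)
    (hsup : W ⊔ J = S) (hinf : W ⊓ J = ⊥) :
    IsCompl (W.comap S.subtype) (J.comap S.subtype) := by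
  constructor
  · rw [disjoint_iff, ← Submodule.comap_inf, hinf]
    simp
  · rw [codisjoint_iff, eq_top_iff]
    rintro ⟨s, hs⟩ -
    obtain ⟨w, hw, j, hj, rfl⟩ := Submodule.mem_sup.1 (hsup.ge hs)
    exact Submodule.mem_sup.2 ⟨⟨w, hW hw⟩, hw, ⟨j, hJ hj⟩, hj, rfl⟩

theorem IsIdealIn.mono {M P I : Submodule K A} (hI : IsIdealIn mul M I) (hIP : I ≤ P)
    (hPM : P ≤ M) : IsIdealIn mul P I :=
  ⟨hIP, fun x hx c hc => hI.2 x (hPM hx) c hc⟩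

/-- In an elementary algebra, an element of square zero acts semisimply on abelian ideals. -/
theorem isSemisimple_restrict_mul [FiniteDimensional K A] (hel : IsElementary mul)
    {M S : Submodule K A} (hS : IsIdealIn mul M S) (hSab : IsAbelian mul S) {x : A} (hx : x ∈ M)
    (hxx : mul x x = 0) (hdich : ∀ s ∈ S, mul s x = 0 ∨ mul s x = -mul x s)
    (hxS : ∀ s ∈ S, mul x s ∈ S) :
    Module.End.IsSemisimple ((mul x).restrict hxS) := by
  have hxM : K ∙ x ≤ M := (Submodule.span_singleton_le_iff_mem x M).2 hx
  have hxs : IsSubalg mul (K ∙ x) := by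
    intro y hy z hz
    obtain ⟨a, rfl⟩ := Submodule.mem_span_singleton.1 hy
    obtain ⟨b, rfl⟩ := Submodule.mem_span_singleton.1 hz
    simp [hxx]
  have hP : IsSubalg mul (S ⊔ K ∙ x) := hS.sup_isSubalg hxM hxs
  have hPM : S ⊔ K ∙ x ≤ M := sup_le hS.1 hxM
  rw [Module.End.isSemisimple_iff]
  intro W hW
  have hWS : W.map S.subtype ≤ S := Submodule.map_subtype_le S W
  have hWI : IsIdealIn mul (S ⊔ K ∙ x) (W.map S.subtype) := by
    refine ⟨hWS.trans le_sup_left, fun y hy w hw => ?_⟩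
    obtain ⟨s, hs, t, ht, rfl⟩ := Submodule.mem_sup.1 hy
    obtain ⟨a, rfl⟩ := Submodule.mem_span_singleton.1 ht
    have hwS := hWS hw
    have hxw : mul x w ∈ W.map S.subtype := by
      obtain ⟨v, hv, rfl⟩ := hw
      exact ⟨_, hW hv, rfl⟩
    have hwx : mul w x ∈ W.map S.subtype := by
      rcases hdich w hwS with h | h <;> rw [h]
      · exact zero_mem _
      · exact neg_mem hxw
    simp only [map_add, map_smul, LinearMap.add_apply, LinearMap.smul_apply, hSab s hs w hwS,
      hSab w hwS s hs, zero_add]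
    exact ⟨Submodule.smul_mem _ _ hxw, Submodule.smul_mem _ _ hwx⟩
  obtain ⟨J, hJ, hJS, hsup, hinf⟩ := exists_isIdealIn_complement hP (hel _ hP)
    (hS.mono le_sup_left hPM) hSab hWI hWS
  rw [← Submodule.comap_map_eq_of_injective S.injective_subtype W]
  refine ⟨J.comap S.subtype, fun s hs => ?_, ?_⟩
  · exact (hJ.2 x (Submodule.mem_sup_right (Submodule.mem_span_singleton_self x)) s hs).1
  · exact isCompl_comap_subtype hWS hJS hsup hinf

theorem IsSubalg.isAbelian_prodSM_of_isElementary [PerfectField K] [FiniteDimensional K A]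
    (hleib : IsLeibniz mul) (hsolv : IsSolvableAlg mul) (hel : IsElementary mul)
    {M : Submodule K A} (hM : IsSubalg mul M) : IsAbelian mul (prodSM mul M M) := by
  induction hn : Module.finrank K M using Nat.strong_induction_on generalizing M with
  | _ n ih =>
  by_cases hM0 : M = ⊥
  · subst hM0
    refine IsAbelian.mono (C := ⊥) (fun x hx y _ => ?_) (prodSM_le.2 fun b hb c _ => ?_)
    · simp [(Submodule.mem_bot K).1 hx]
    · simp [(Submodule.mem_bot K).1 hb]
  obtain ⟨D, hD, hDab, hD0⟩ :=
    exists_isAbelian_isIdealIn hleib hM (hsolv.isSolvableSubalg M) hM0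
  obtain ⟨S, hSD, hS, hS0, hmin⟩ := exists_minimal_isIdealIn_le hD hD0
  have hSab : IsAbelian mul S := hDab.mono hSD
  obtain ⟨C, hCM, hC, hsup, hinf⟩ := exists_isSubalg_complement hM (hel M hM) hS hSab
  have hlt : C < M := lt_of_le_of_ne hCM fun h => hS0 <| by
    rw [← hinf, h, inf_eq_left.2 hS.1]
  have hUab : IsAbelian mul (prodSM mul C C) :=
    ih _ (hn ▸ Submodule.finrank_lt_finrank_of_lt hlt) hC rfl
  have hU : IsIdealIn mul C (prodSM mul C C) := hC.isIdealIn_self.prodSM_self hleib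
  have hdich := right_mul_eq_zero_or_neg hleib hM hS hmin
  have hbr : ∀ c ∈ C, ∀ u ∈ prodSM mul C C, ∀ s ∈ S,
      mul c (mul u s) - mul u (mul c s) = 0 := by
    intro c hc u hu s hs
    have huM : u ∈ M := hCM (hU.1 hu)
    have hmS : ∀ x ∈ M, ∀ s ∈ S, mul x s ∈ S := fun x hx s hs => (hS.2 x hx s hs).1
    have hss := isSemisimple_restrict_mul hel hS hSab huM (hUab u hu u hu)
      (fun s hs => hdich.imp (fun h => h u huM s hs) (fun h => h u huM s hs)) (hmS u huM)
    have h0 := commutator_eq_zero_of_isSemisimple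
      (a := (mul c).restrict (hmS c (hCM hc))) hss ?_
    · have := congrArg (fun f : Module.End K S => (f ⟨s, hs⟩ : A)) h0
      simpa using this
    · ext t
      have h1 := hleib u (mul c u) t
      have h2 := hUab u hu _ (hU.2 c hc u hu).1
      rw [h2, LinearMap.map_zero, LinearMap.zero_apply, zero_add] at h1
      simpa [hleib.mul_mul_apply] using h1
  have hUS : ∀ u ∈ prodSM mul C C, ∀ s ∈ S, mul u s = 0 := by
    obtain ⟨E, hEC, hE, hEsup, hEinf⟩ := exists_isSubalg_complement hC (hel C hC) hU hUab
    have hgen : prodSM mul C C ≤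
        prodSM mul C (prodSM mul C C) ⊔ prodSM mul (prodSM mul C C) C := by
      refine prodSM_le.2 fun b hb c hc => ?_
      obtain ⟨u, hu, e, he, rfl⟩ := Submodule.mem_sup.1 (hEsup.ge hb)
      obtain ⟨v, hv, f, hf, rfl⟩ := Submodule.mem_sup.1 (hEsup.ge hc)
      have hef : mul e f = 0 := by
        rw [← Submodule.mem_bot K, ← hEinf]
        exact ⟨mul_mem_prodSM (hEC he) (hEC hf), hE e he f hf⟩
      have h : mul (u + e) (v + f) = mul e v + mul u (v + f) := by
        simp only [map_add, LinearMap.add_apply, hef]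
        abel
      rw [h]
      exact Submodule.add_mem_sup (mul_mem_prodSM (hEC he) hv) (mul_mem_prodSM hu hc)
    intro u hu s hs
    have hker : prodSM mul C (prodSM mul C C) ⊔ prodSM mul (prodSM mul C C) C ≤
        LinearMap.ker (mul.flip s) := by
      refine sup_le (prodSM_le.2 fun c hc v hv => ?_) (prodSM_le.2 fun v hv c hc => ?_)
      · simpa [hleib.mul_mul_apply] using hbr c hc v hv s hs
      · simpa [hleib.mul_mul_apply] using neg_eq_zero.2 (hbr c hc v hv s hs)
    exact hker (hgen hu)
  have hSU : ∀ u ∈ prodSM mul C C, ∀ s ∈ S, mul s u = 0 := by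
    intro u hu s hs
    have huM : u ∈ M := hCM (hU.1 hu)
    rcases hdich with h | h
    · exact h u huM s hs
    · rw [h u huM s hs, hUS u hu s hs, neg_zero]
  refine IsAbelian.mono (C := S ⊔ prodSM mul C C) ?_ (prodSM_le.2 fun b hb c hc => ?_)
  · intro x hx y hy
    obtain ⟨s, hs, u, hu, rfl⟩ := Submodule.mem_sup.1 hx
    obtain ⟨t, ht, v, hv, rfl⟩ := Submodule.mem_sup.1 hy
    simp [hSab s hs t ht, hUab u hu v hv, hUS u hu t ht, hSU v hv s hs]
  · have hb' := hb
    obtain ⟨s, hs, e, he, rfl⟩ := Submodule.mem_sup.1 (hsup.ge hb)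
    obtain ⟨t, ht, f, hf, rfl⟩ := Submodule.mem_sup.1 (hsup.ge hc)
    have h : mul (s + e) (t + f) = (mul (s + e) t + mul s f) + mul e f := by
      simp only [map_add, LinearMap.add_apply]
      abel
    rw [h]
    exact Submodule.add_mem_sup (S.add_mem (hS.2 _ hb' t ht).1 (hS.2 f (hCM hf) s hs).2)
      (mul_mem_prodSM he hf)

/-- If the Frattini ideal of `M` vanishes, then nilpotent ideals of `M` are abelian. -/
theorem IsIdealIn.isAbelian_of_isNilpotentSubalg [FiniteDimensional K A] (hleib : IsLeibniz mul)
    {M N : Submodule K A} (hΦ : frattiniIdealIn mul M = ⊥)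
    (hN : IsIdealIn mul M N) (hnil : IsNilpotentSubalg mul N) : IsAbelian mul N := by
  rw [frattiniIdealIn_eq_bot_iff] at hΦ
  rw [isAbelian_iff_prodSM_eq_bot]
  by_contra hne
  obtain ⟨T, hTM, hT, hTne, hsup⟩ := hΦ _ (hN.prodSM_self hleib) hne
  have hNN : prodSM mul N N ≤ N := prodSM_le.2 hN.isSubalg
  have hstep : ∀ k, lcsOf mul N k ≤ lcsOf mul N (k + 1) ⊔ T ⊓ lcsOf mul N k := by
    intro k
    induction k with
    | zero =>
      have h : N ≤ (prodSM mul N N ⊔ T) ⊓ N := le_inf (hsup.symm ▸ hN.1) le_rfl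
      rwa [sup_inf_assoc_of_le _ hNN] at h
    | succ k ih =>
      refine prodSM_le.2 fun b hb c hc => ?_
      have hb' : b ∈ prodSM mul N N ⊔ T ⊓ N := by
        have h : N ≤ (prodSM mul N N ⊔ T) ⊓ N := le_inf (hsup.symm ▸ hN.1) le_rfl
        rw [sup_inf_assoc_of_le _ hNN] at h
        exact h hb
      obtain ⟨d, hd, t, ht, rfl⟩ := Submodule.mem_sup.1 hb'
      obtain ⟨e, he, u, hu, rfl⟩ := Submodule.mem_sup.1 (ih hc)
      have hdc : mul d (e + u) ∈ lcsOf mul N (k + 2) := by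
        have h : prodSM mul N N ≤ (lcsOf mul N (k + 2)).comap (mul.flip (e + u)) := by
          refine prodSM_le.2 fun x hx y hy => ?_
          change mul (mul x y) (e + u) ∈ lcsOf mul N (k + 2)
          rw [hleib.mul_mul_apply]
          exact sub_mem (mul_mem_prodSM hx (mul_mem_prodSM hy hc))
            (mul_mem_prodSM hy (mul_mem_prodSM hx hc))
        exact h hd
      have h : mul (d + t) (e + u) = (mul d (e + u) + mul t e) + mul t u := by
        simp only [map_add, LinearMap.add_apply]
        abel
      rw [h]
      exact Submodule.add_mem_sup (add_mem hdc (mul_mem_prodSM ht.2 he))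
        ⟨hT t ht.1 u hu.1, mul_mem_prodSM ht.2 hu.2⟩
  have hle : ∀ k, N ≤ T ⊔ lcsOf mul N k := by
    intro k
    induction k with
    | zero => exact le_sup_right
    | succ k ih =>
      refine ih.trans (sup_le le_sup_left ((hstep k).trans ?_))
      exact sup_le le_sup_right (inf_le_left.trans le_sup_left)
  obtain ⟨n, hn⟩ := hnil
  have hNT : N ≤ T := by simpa [hn] using hle n
  exact hTne (le_antisymm hTM (hsup ▸ sup_le (hNN.trans hNT) le_rfl))

theorem isSubalg_top : IsSubalg mul ⊤ :=
  fun _ _ _ _ => Submodule.mem_top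

theorem isIdeal_asocle : IsIdeal mul (asocle mul) := by
  intro a b hb
  have hl : asocle mul ≤ (asocle mul).comap (mul a) :=
    sSup_le fun m hm x hx => le_sSup (a := m) hm (hm.1.1 a x hx).1
  have hr : asocle mul ≤ (asocle mul).comap (mul.flip a) :=
    sSup_le fun m hm x hx => le_sSup (a := m) hm (hm.1.1 a x hx).2
  exact ⟨hl hb, hr hb⟩

theorem isAbelian_asocle : IsAbelian mul (asocle mul) := by
  have hmm : ∀ m n : Submodule K A, IsMinIdeal mul m ∧ IsAbelian mul m →
      IsMinIdeal mul n ∧ IsAbelian mul n → ∀ x ∈ m, ∀ y ∈ n, mul x y = 0 := by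
    intro m n hm hn x hx y hy
    by_cases hmn : m = n
    · exact hm.2 x hx y (hmn ▸ hy)
    · have hinf : IsIdeal mul (m ⊓ n) := isIdealIn_top.1
        ((isIdealIn_top.2 hm.1.1).inf (isIdealIn_top.2 hn.1.1))
      have hbot : m ⊓ n = ⊥ := by
        refine (hm.1.2.2 _ hinf inf_le_left).resolve_right fun h => ?_
        rcases hn.1.2.2 m hm.1.1 (inf_eq_left.1 h) with h' | h'
        · exact hm.1.2.1 h'
        · exact hmn h'
      rw [← Submodule.mem_bot K, ← hbot]
      exact ⟨(hm.1.1 y x hx).2, (hn.1.1 x y hy).1⟩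
  have h1 : ∀ m : Submodule K A, IsMinIdeal mul m ∧ IsAbelian mul m → ∀ x ∈ m,
      asocle mul ≤ LinearMap.ker (mul x) := fun m hm x hx =>
    sSup_le fun n hn y hy => hmm m n hm hn x hx y hy
  intro x hx y hy
  have h2 : asocle mul ≤ LinearMap.ker (mul.flip y) :=
    sSup_le fun m hm x hx => h1 m hm x hx hy
  exact h2 hx

/-- If the Frattini ideal vanishes, every abelian ideal lies in the abelian socle. -/
theorem IsIdeal.le_asocle [FiniteDimensional K A] (hΦ : frattiniIdeal mul = ⊥)
    {N : Submodule K A} (hN : IsIdeal mul N) (hab : IsAbelian mul N) : N ≤ asocle mul := by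
  have hN' : IsIdealIn mul ⊤ N := isIdealIn_top.2 hN
  have hinf : IsIdealIn mul ⊤ (N ⊓ asocle mul) := hN'.inf (isIdealIn_top.2 isIdeal_asocle)
  obtain ⟨J, hJ, hJN, hsup, hbot⟩ :=
    exists_isIdealIn_complement isSubalg_top hΦ hN' hab hinf inf_le_left
  by_cases hJ0 : J = ⊥
  · rw [hJ0, sup_bot_eq] at hsup
    exact inf_eq_left.1 hsup
  · obtain ⟨S, hSJ, hS, hS0, hmin⟩ := exists_minimal_isIdealIn_le hJ hJ0
    refine absurd ?_ hS0
    have hSN := hSJ.trans hJN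
    have hSas : S ≤ asocle mul := le_sSup (a := S) ⟨⟨isIdealIn_top.1 hS, hS0, fun C hC hCS =>
      hmin C (isIdealIn_top.2 hC) hCS⟩, hab.mono hSN⟩
    exact eq_bot_iff.2 (hbot ▸ le_inf (le_inf hSN hSas) hSJ)

theorem isIdeal_derivedSubalg (hleib : IsLeibniz mul) : IsIdeal mul (derivedSubalg mul) :=
  isIdealIn_top.1 (isSubalg_top.isIdealIn_self.prodSM_self hleib)

theorem exists_isAbelian_complement_asocle [FiniteDimensional K A] (hleib : IsLeibniz mul)
    (hΦ : frattiniIdeal mul = ⊥) (hab : IsAbelian mul (derivedSubalg mul)) :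
    ∃ B : Submodule K A, IsSubalg mul B ∧ IsAbelian mul B ∧
      asocle mul ⊔ B = ⊤ ∧ asocle mul ⊓ B = ⊥ := by
  have hle := (isIdeal_derivedSubalg hleib).le_asocle hΦ hab
  obtain ⟨B, -, hB, hsup, hinf⟩ := exists_isSubalg_complement isSubalg_top hΦ
    (isIdealIn_top.2 isIdeal_asocle) isAbelian_asocle
  refine ⟨B, hB, fun x hx y hy => ?_, hsup, hinf⟩
  rw [← Submodule.mem_bot K, ← hinf]
  exact ⟨hle (mul_mem_prodSM trivial trivial), hB x hx y hy⟩

variable (mul) in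
/-- The endomorphisms of a subspace `S` induced by left and right multiplications by elements
of `M`. -/
def multiplications (S M : Submodule K A) : Set (Module.End K S) :=
  {f | ∃ x ∈ M, (∀ s : S, (f s : A) = mul x s) ∨ (∀ s : S, (f s : A) = mul s x)}

theorem multiplications_mono {S M N : Submodule K A} (h : M ≤ N) :
    multiplications mul S M ⊆ multiplications mul S N :=
  fun _ ⟨x, hx, hf⟩ => ⟨x, h hx, hf⟩

theorem right_mul_comm_asocle (hleib : IsLeibniz mul)
    (hder : derivedSubalg mul ≤ asocle mul) (x y : A) {s : A} (hs : s ∈ asocle mul) :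
    mul (mul s x) y = mul (mul s y) x := by
  have h : asocle mul ≤ LinearMap.eqLocus (mul.flip y ∘ₗ mul.flip x)
      (mul.flip x ∘ₗ mul.flip y) := by
    refine sSup_le fun m hm t ht => ?_
    change mul (mul t x) y = mul (mul t y) x
    have hmin : ∀ J, IsIdealIn mul ⊤ J → J ≤ m → J = ⊥ ∨ J = m := fun J hJ hJm =>
      hm.1.2.2 J (isIdealIn_top.1 hJ) hJm
    rcases right_mul_eq_zero_or_neg hleib isSubalg_top (isIdealIn_top.2 hm.1.1)
      hmin with h | h
    · simp [h _ trivial t ht]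
    · have hz : mul (mul x y) t = 0 :=
        isAbelian_asocle _ (hder (mul_mem_prodSM trivial trivial)) _ (le_sSup (a := m) hm ht)
      have hxy := hleib x y t
      rw [hz, zero_add] at hxy
      rw [h x trivial t ht, h y trivial t ht, map_neg, map_neg, LinearMap.neg_apply,
        LinearMap.neg_apply, h _ trivial _ (hm.1.1 x t ht).1, h _ trivial _ (hm.1.1 y t ht).1,
        hxy]
  exact h hs

theorem commute_of_mem_multiplications (hleib : IsLeibniz mul)
    (hder : derivedSubalg mul ≤ asocle mul) :
    ∀ f ∈ multiplications mul (asocle mul) ⊤, ∀ g ∈ multiplications mul (asocle mul) ⊤,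
      f * g = g * f := by
  have hz : ∀ x y, ∀ s ∈ asocle mul, mul (mul x y) s = 0 ∧ mul s (mul x y) = 0 :=
    fun x y s hs => ⟨isAbelian_asocle _ (hder (mul_mem_prodSM trivial trivial)) _ hs,
      isAbelian_asocle _ hs _ (hder (mul_mem_prodSM trivial trivial))⟩
  have hLR : ∀ x y, ∀ s ∈ asocle mul, mul x (mul s y) = mul (mul x s) y := fun x y s hs => by
    rw [hleib x s y, (hz x y s hs).2, add_zero]
  rintro f ⟨x, -, hf | hf⟩ g ⟨y, -, hg | hg⟩ <;> ext s <;>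
    simp only [Module.End.mul_apply, hf, hg]
  · rw [hleib x y s, (hz x y s s.2).1, zero_add]
  · exact hLR x y s s.2
  · exact (hLR y x s s.2).symm
  · exact right_mul_comm_asocle hleib hder y x s.2

theorem eq_zero_of_mem_adjoin_multiplications (hleib : IsLeibniz mul)
    (hder : derivedSubalg mul ≤ asocle mul) {r : Module.End K (asocle mul)}
    (hr : r ∈ Algebra.adjoin K (multiplications mul (asocle mul) ⊤)) (hrr : r * r = 0) :
    r = 0 := by
  have hcomm : ∀ f ∈ multiplications mul (asocle mul) ⊤, ∀ s, r (f s) = f (r s) := by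
    intro f hf s
    have := Algebra.commute_of_mem_adjoin_of_forall_mem_commute hr
      (fun g hg => commute_of_mem_multiplications hleib hder f hf g hg)
    exact (LinearMap.congr_fun this.eq s).symm
  have hinv : ∀ m, IsIdeal mul m → ∀ s : asocle mul, (s : A) ∈ m → (r s : A) ∈ m := by
    intro m hm
    clear hcomm hrr
    induction hr using Algebra.adjoin_induction with
    | mem f hf =>
      obtain ⟨x, -, hf | hf⟩ := hf
      · exact fun s hs => hf s ▸ (hm x s hs).1
      · exact fun s hs => hf s ▸ (hm x s hs).2
    | algebraMap c => exact fun s hs => m.smul_mem c hs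
    | add f g _ _ hf hg => exact fun s hs => m.add_mem (hf s hs) (hg s hs)
    | mul f g _ _ hf hg => exact fun s hs => hf _ (hg s hs)
  have hker : IsIdeal mul ((LinearMap.ker r).map (asocle mul).subtype) := by
    rintro a _ ⟨s, hs, rfl⟩
    have hs' : r s = 0 := hs
    let f : Module.End K (asocle mul) :=
      (mul a).restrict fun s hs => (isIdeal_asocle a s hs).1
    let g : Module.End K (asocle mul) :=
      (mul.flip a).restrict fun s hs => (isIdeal_asocle a s hs).2
    refine ⟨⟨f s, ?_, rfl⟩, ⟨g s, ?_, rfl⟩⟩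
    · change r (f s) = 0
      rw [hcomm f ⟨a, trivial, Or.inl fun _ => rfl⟩, hs', map_zero]
    · change r (g s) = 0
      rw [hcomm g ⟨a, trivial, Or.inr fun _ => rfl⟩, hs', map_zero]
  have hle : asocle mul ≤ (LinearMap.ker r).map (asocle mul).subtype := by
    refine sSup_le fun m hm => ?_
    have hideal := isIdealIn_top.1 ((isIdealIn_top.2 hker).inf (isIdealIn_top.2 hm.1.1))
    rcases hm.1.2.2 _ hideal inf_le_right with h | h
    · intro t ht
      have hts : t ∈ asocle mul := le_sSup (a := m) hm ht
      refine ⟨⟨t, hts⟩, ?_, rfl⟩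
      have hmem : (r ⟨t, hts⟩ : A) ∈ (LinearMap.ker r).map (asocle mul).subtype ⊓ m :=
        ⟨⟨_, LinearMap.congr_fun hrr ⟨t, hts⟩, rfl⟩, hinv m hm.1.1 _ ht⟩
      rw [h, Submodule.mem_bot] at hmem
      exact Subtype.ext hmem
    · exact inf_eq_right.1 h
  ext s
  obtain ⟨t, ht, hts⟩ := hle s.2
  have : t = s := Subtype.ext hts
  subst this
  simpa using congrArg Subtype.val (show r t = 0 from ht)

open scoped IsMulCommutative in
/-- If `A²` lies in the abelian socle, then the abelian socle is completely reducible under the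
multiplications by any subspace of `A`. -/
theorem exists_invariant_complement_asocle [FiniteDimensional K A] (hleib : IsLeibniz mul)
    (hder : derivedSubalg mul ≤ asocle mul) {M P : Submodule K A} (hP : P ≤ asocle mul)
    (hPM : ∀ x ∈ M, ∀ p ∈ P, mul x p ∈ P ∧ mul p x ∈ P) :
    ∃ W ≤ asocle mul, P ⊔ W = asocle mul ∧ P ⊓ W = ⊥ ∧
      ∀ x ∈ M, ∀ w ∈ W, mul x w ∈ W ∧ mul w x ∈ W := by
  have hsub := multiplications_mono (mul := mul) (S := asocle mul) (le_top : M ≤ ⊤)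
  obtain ⟨R, hR⟩ : ∃ R, R = Algebra.adjoin K (multiplications mul (asocle mul) M) := ⟨_, rfl⟩
  have hRc : IsMulCommutative R := hR ▸ Algebra.isMulCommutative_adjoin K fun f hf g hg =>
    commute_of_mem_multiplications hleib hder f (hsub hf) g (hsub hg)
  have hRred : IsReduced R := by
    refine (isReduced_iff_pow_one_lt 2 one_lt_two).2 fun r hr => Subtype.ext ?_
    refine eq_zero_of_mem_adjoin_multiplications hleib hder
      (Algebra.adjoin_mono hsub (hR.le r.2)) ?_
    rw [← sq]
    exact congrArg Subtype.val hr
  have hRart : IsArtinianRing R := .of_finite K R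
  have hRss : IsSemisimpleRing R := IsArtinianRing.isSemisimpleRing_of_isReduced R
  have hPinv : ∀ r ∈ R, ∀ s : asocle mul, (s : A) ∈ P → (r s : A) ∈ P := by
    intro r hr
    rw [hR] at hr
    induction hr using Algebra.adjoin_induction with
    | mem f hf =>
      obtain ⟨x, hx, hf | hf⟩ := hf
      · exact fun s hs => hf s ▸ (hPM x hx s hs).1
      · exact fun s hs => hf s ▸ (hPM x hx s hs).2
    | algebraMap c => exact fun s hs => P.smul_mem c hs
    | add f g _ _ hf hg => exact fun s hs => P.add_mem (hf s hs) (hg s hs)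
    | mul f g _ _ hf hg => exact fun s hs => hf _ (hg s hs)
  let P' : Submodule R (asocle mul) :=
    { P.comap (asocle mul).subtype with smul_mem' := fun r s hs => hPinv r r.2 s hs }
  have hss : IsSemisimpleModule R (asocle mul) := inferInstance
  have := (isSemisimpleModule_iff R (asocle mul)).1 hss
  obtain ⟨Q, hQ⟩ := exists_isCompl P'
  have hQ' : ∀ f ∈ multiplications mul (asocle mul) M, ∀ q ∈ Q, f q ∈ Q := fun f hf q hq =>
    Q.smul_mem (⟨f, hR ▸ Algebra.subset_adjoin hf⟩ : R) hq
  refine ⟨(Q.restrictScalars K).map (asocle mul).subtype, Submodule.map_subtype_le _ _, ?_, ?_, ?_⟩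
  · refine le_antisymm (sup_le hP (Submodule.map_subtype_le _ _)) fun s hs => ?_
    have h : (⟨s, hs⟩ : asocle mul) ∈ P' ⊔ Q := hQ.sup_eq_top ▸ Submodule.mem_top
    obtain ⟨p, hp, q, hq, hpq⟩ := Submodule.mem_sup.1 h
    exact Submodule.mem_sup.2 ⟨p, hp, q, ⟨q, hq, rfl⟩, congrArg Subtype.val hpq⟩
  · refine eq_bot_iff.2 ?_
    rintro _ ⟨hp, ⟨q, hq, rfl⟩⟩
    have h : q ∈ P' ⊓ Q := ⟨hp, hq⟩
    rw [hQ.inf_eq_bot, Submodule.mem_bot] at h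
    simp [h]
  · rintro x hx _ ⟨q, hq, rfl⟩
    let f : Module.End K (asocle mul) :=
      (mul x).restrict fun s hs => (isIdeal_asocle x s hs).1
    let g : Module.End K (asocle mul) :=
      (mul.flip x).restrict fun s hs => (isIdeal_asocle x s hs).2
    exact ⟨⟨f q, hQ' f ⟨x, hx, Or.inl fun _ => rfl⟩ q hq, rfl⟩,
      ⟨g q, hQ' g ⟨x, hx, Or.inr fun _ => rfl⟩ q hq, rfl⟩⟩

theorem derivedSubalg_le_asocle {B : Submodule K A} (hab : IsAbelian mul B)
    (hsup : asocle mul ⊔ B = ⊤) : derivedSubalg mul ≤ asocle mul := by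
  refine prodSM_le.2 fun x _ y _ => ?_
  obtain ⟨s, hs, b, hb, rfl⟩ := Submodule.mem_sup.1 (hsup.ge (Submodule.mem_top (x := x)))
  obtain ⟨t, ht, c, hc, rfl⟩ := Submodule.mem_sup.1 (hsup.ge (Submodule.mem_top (x := y)))
  have h : mul (s + b) (t + c) = mul (s + b) t + mul s c := by
    simp only [map_add, LinearMap.add_apply, hab b hb c hc]
    abel
  rw [h]
  exact add_mem (isIdeal_asocle _ t ht).1 (isIdeal_asocle c s hs).2

theorem isElementary_of_isAbelian_complement_asocle [FiniteDimensional K A]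
    (hleib : IsLeibniz mul) {B : Submodule K A} (hab : IsAbelian mul B)
    (hsup : asocle mul ⊔ B = ⊤) (hinf : asocle mul ⊓ B = ⊥) : IsElementary mul := by
  intro M hM
  have hder := derivedSubalg_le_asocle hab hsup
  rw [frattiniIdealIn_eq_bot_iff]
  intro I hI hI0
  by_cases hIS : I ⊓ asocle mul = ⊥
  · obtain ⟨Q, hQ⟩ := exists_isCompl (I ⊔ (M ⊓ asocle mul))
    have hle : M ⊓ asocle mul ≤ M ⊓ ((M ⊓ asocle mul) ⊔ Q) := le_inf inf_le_left le_sup_left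
    have hIT : I ⊔ M ⊓ ((M ⊓ asocle mul) ⊔ Q) = M := by
      rw [inf_comm, ← sup_inf_assoc_of_le _ hI.1, ← sup_assoc, hQ.sup_eq_top, top_inf_eq]
    refine ⟨M ⊓ ((M ⊓ asocle mul) ⊔ Q), inf_le_left, fun x hx y hy => hle ⟨hM x hx.1 y hy.1,
      hder (mul_mem_prodSM trivial trivial)⟩, fun h => hI0 ?_, hIT⟩
    refine eq_bot_iff.2 fun i hi => ?_
    obtain ⟨s, hs, q, hq, hsq⟩ := Submodule.mem_sup.1 (h.ge (hI.1 hi)).2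
    have hq0 : q = 0 := by
      rw [← Submodule.mem_bot K, ← hQ.inf_eq_bot]
      refine ⟨?_, hq⟩
      rw [← eq_sub_iff_add_eq'] at hsq
      rw [hsq]
      exact sub_mem (Submodule.mem_sup_left hi) (Submodule.mem_sup_right hs)
    rw [← hIS]
    refine ⟨hi, ?_⟩
    rw [← hsq, hq0, add_zero]
    exact hs.2
  · have hPM : ∀ x ∈ M, ∀ p ∈ I ⊓ asocle mul,
        mul x p ∈ I ⊓ asocle mul ∧ mul p x ∈ I ⊓ asocle mul := fun x hx p hp =>
      ⟨⟨(hI.2 x hx p hp.1).1, (isIdeal_asocle x p hp.2).1⟩,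
        ⟨(hI.2 x hx p hp.1).2, (isIdeal_asocle x p hp.2).2⟩⟩
    obtain ⟨W, hWS, hWsup, hWinf, hWM⟩ :=
      exists_invariant_complement_asocle hleib hder inf_le_right hPM
    have hPT : (I ⊓ asocle mul) ⊓ (M ⊓ (W ⊔ B)) = ⊥ := by
      refine eq_bot_iff.2 fun p hp => ?_
      obtain ⟨w, hw, b, hb, hwb⟩ := Submodule.mem_sup.1 hp.2.2
      have hb0 : b = 0 := by
        rw [← Submodule.mem_bot K, ← hinf]
        refine ⟨?_, hb⟩
        rw [← eq_sub_iff_add_eq'] at hwb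
        rw [hwb]
        exact sub_mem hp.1.2 (hWS hw)
      rw [hb0, add_zero] at hwb
      rw [← hWinf]
      exact ⟨hp.1, hwb ▸ hw⟩
    refine ⟨M ⊓ (W ⊔ B), inf_le_left, fun x hx y hy => ⟨hM x hx.1 y hy.1, ?_⟩, fun h => ?_, ?_⟩
    · obtain ⟨w, hw, b, hb, hwb⟩ := Submodule.mem_sup.1 hx.2
      obtain ⟨v, hv, c, hc, hvc⟩ := Submodule.mem_sup.1 hy.2
      have hwv := isAbelian_asocle w (hWS hw) v (hWS hv)
      have h : mul x y = mul w y + mul x v := by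
        simp only [← hwb, ← hvc, map_add, LinearMap.add_apply, hab b hb c hc, hwv]
        abel
      rw [h]
      exact Submodule.mem_sup_left (add_mem (hWM y hy.1 w hw).2 (hWM x hx.1 v hv).1)
    · rw [h, inf_eq_left.2 (inf_le_left.trans hI.1)] at hPT
      exact hIS hPT
    · refine le_antisymm (sup_le hI.1 inf_le_left) ?_
      have htop : (I ⊓ asocle mul) ⊔ (W ⊔ B) = ⊤ := by rw [← sup_assoc, hWsup, hsup]
      have : (I ⊓ asocle mul) ⊔ (M ⊓ (W ⊔ B)) = M := by
        rw [inf_comm M, ← sup_inf_assoc_of_le _ (inf_le_left.trans hI.1), htop, top_inf_eq]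
      exact this.ge.trans (sup_le_sup_right inf_le_left _)

end Elementary

end Leib

open Leib

variable {K : Type*} [Field K] {A : Type*} [AddCommGroup A] [Module K A]
variable (mul : A →ₗ[K] A →ₗ[K] A)

/-- For a finite-dimensional solvable Leibniz algebra over a perfect field, the
following are equivalent: elementary; `Φ(A) = 0` with `A²` nilpotent; `Φ(A) = 0`
with `A` metabelian; `Asoc(A)` is complemented by an abelian subalgebra. -/
theorem stmt19 [PerfectField K] [FiniteDimensional K A]
    (hleib : IsLeibniz mul) (hsolv : IsSolvableAlg mul) :
    List.TFAE
      [IsElementary mul,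
       frattiniIdeal mul = ⊥ ∧ IsNilpotentSubalg mul (derivedSubalg mul),
       frattiniIdeal mul = ⊥ ∧ IsAbelian mul (derivedSubalg mul),
       ∃ B : Submodule K A, IsSubalg mul B ∧ IsAbelian mul B ∧
         asocle mul ⊔ B = ⊤ ∧ asocle mul ⊓ B = ⊥] := by
  tfae_have 1 → 3 := fun h =>
    ⟨h ⊤ isSubalg_top, isSubalg_top.isAbelian_prodSM_of_isElementary hleib hsolv h⟩
  tfae_have 3 → 2 := fun h => ⟨h.1, 1, isAbelian_iff_prodSM_eq_bot.1 h.2⟩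
  tfae_have 2 → 4 := fun h => exists_isAbelian_complement_asocle hleib h.1 <|
    IsIdealIn.isAbelian_of_isNilpotentSubalg hleib h.1
      (isIdealIn_top.2 (isIdeal_derivedSubalg hleib)) h.2
  tfae_have 4 → 1 := fun ⟨_, _, hab, hsup, hinf⟩ =>
    isElementary_of_isAbelian_complement_asocle hleib hab hsup hinf
  tfae_finish
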